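/- arXiv:1002.2137 — 3 statements merged into one kernel-verified Lean document; each statement's English description precedes it below -/
import Mathlib

section
/- Every weak solution u of −|u′|^α u″ = f_{a,A}(u) on an open interval I is a viscosity solution of |u′|^α u″ + f_{a,A}(u) = 0 on I, in the following sense: (i) if u is constant equal to some value c on a nonempty open subinterval of I, then f_{a,A}(c) = 0; (ii) for every x₀ ∈ I and every C² function φ such that u − φ has a local maximum at x₀ and φ′(x₀) ≠ 0, one has |φ′(x₀)|^α φ″(x₀) + f_{a,A}(u(x₀)) ≥ 0; and (iii) for every x₀ ∈ I and every C² function φ such that u − φ has a local minimum at x₀ and φ′(x₀) ≠ 0, one has |φ′(x₀)|^α φ″(x₀) + f_{a,A}(u(x₀)) ≤ 0. -/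
noncomputable section

open Real Filter Topology intervalIntegral

/-- The normalized nonlinearity `f_{a,A}`: `f/a` where `f > 0`, `f/A` where `f < 0`,
and `0` where `f = 0`. -/
def faA (a A : ℝ) (f : ℝ → ℝ) (t : ℝ) : ℝ :=
  if 0 < f t then f t / a else if f t < 0 then f t / A else 0

/-- `u` is a weak solution of `-|u'|^α u'' = f_{a,A}(u)` on all of `ℝ`:
`u` is C¹ and `x ↦ |u'|^α u'` is differentiable with (continuous) derivative
`-(1+α)·f_{a,A}(u(x))`. -/
def IsWeakSolR (α a A : ℝ) (f : ℝ → ℝ) (u : ℝ → ℝ) : Prop :=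
  Differentiable ℝ u ∧ Continuous (deriv u) ∧
  ∀ x : ℝ, HasDerivAt (fun y => |deriv u y| ^ α * deriv u y)
    (-(1 + α) * faA a A f (u x)) x

theorem abs_rpow_mul_self_of_nonneg {α s : ℝ} (hα : -1 < α) (hs : 0 ≤ s) :
    |s| ^ α * s = s ^ (α + 1) := by
  rcases hs.eq_or_lt with rfl | hs
  · rw [mul_zero, Real.zero_rpow (by linarith)]
  · rw [abs_of_pos hs, Real.rpow_add_one hs.ne']

theorem abs_rpow_mul_self_of_nonpos {α s : ℝ} (hα : -1 < α) (hs : s ≤ 0) :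
    |s| ^ α * s = -(-s) ^ (α + 1) := by
  rw [← abs_rpow_mul_self_of_nonneg hα (neg_nonneg.2 hs), abs_neg]
  ring

theorem monotone_abs_rpow_mul_self {α : ℝ} (hα : -1 < α) :
    Monotone fun s : ℝ => |s| ^ α * s := by
  intro s t hst
  have h1 : 0 ≤ α + 1 := by linarith
  rcases le_total 0 s with hs | hs
  · simp only [abs_rpow_mul_self_of_nonneg hα hs, abs_rpow_mul_self_of_nonneg hα (hs.trans hst)]
    exact Real.rpow_le_rpow hs hst h1
  · rcases le_total 0 t with ht | ht
    · exact (mul_nonpos_of_nonneg_of_nonpos (Real.rpow_nonneg (abs_nonneg s) α) hs).trans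
        (mul_nonneg (Real.rpow_nonneg (abs_nonneg t) α) ht)
    · simp only [abs_rpow_mul_self_of_nonpos hα hs, abs_rpow_mul_self_of_nonpos hα ht]
      exact neg_le_neg (Real.rpow_le_rpow (by linarith) (by linarith) h1)

theorem hasDerivAt_abs_rpow_mul_self {α p : ℝ} (hα : -1 < α) (hp : p ≠ 0) :
    HasDerivAt (fun s : ℝ => |s| ^ α * s) ((1 + α) * |p| ^ α) p := by
  rcases hp.lt_or_gt with hp | hp
  · have h := ((hasDerivAt_neg p).rpow_const (p := α + 1) (Or.inl (by linarith))).neg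
    rw [abs_of_neg hp]
    refine (h.congr_deriv ?_).congr_of_eventuallyEq ?_
    · rw [add_sub_cancel_right]
      ring
    · filter_upwards [gt_mem_nhds hp] with s hs
      exact abs_rpow_mul_self_of_nonpos hα hs.le
  · have h := (hasDerivAt_id p).rpow_const (p := α + 1) (Or.inl hp.ne')
    rw [abs_of_pos hp]
    refine (h.congr_deriv ?_).congr_of_eventuallyEq ?_
    · rw [add_sub_cancel_right]
      simp only [id]
      ring
    · filter_upwards [lt_mem_nhds hp] with s hs
      exact abs_rpow_mul_self_of_nonneg hα hs.le

/-- Second-order necessary condition at a local maximum of `u - v`, where the derivatives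
are only observed through a monotone function `g`. -/
theorem IsLocalMax.hasDerivAt_comp_deriv_le {g u v : ℝ → ℝ} (hg : Monotone g) {x₀ c d : ℝ}
    (hu : ∀ᶠ x in 𝓝 x₀, DifferentiableAt ℝ u x) (hv : ∀ᶠ x in 𝓝 x₀, DifferentiableAt ℝ v x)
    (hc : HasDerivAt (fun x => g (deriv u x)) c x₀)
    (hd : HasDerivAt (fun x => g (deriv v x)) d x₀)
    (hmax : IsLocalMax (fun x => u x - v x) x₀) : c ≤ d := by
  by_contra! hlt
  have hderiv : deriv u x₀ = deriv v x₀ := by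
    have h := hmax.hasDerivAt_eq_zero (hu.self_of_nhds.hasDerivAt.sub hv.self_of_nhds.hasDerivAt)
    linarith
  have hslope := (hasDerivAt_iff_tendsto_slope.1 (hc.sub hd)).mono_left
    (nhdsWithin_mono x₀ fun x (hx : x ∈ Set.Ioi x₀) => ne_of_gt hx)
  have hev : ∀ᶠ x in 𝓝[>] x₀, DifferentiableAt ℝ u x ∧ DifferentiableAt ℝ v x ∧
      u x - v x ≤ u x₀ - v x₀ ∧ deriv v x < deriv u x := by
    filter_upwards [hslope.eventually (lt_mem_nhds (sub_pos.2 hlt)), self_mem_nhdsWithin,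
      hu.filter_mono nhdsWithin_le_nhds, hv.filter_mono nhdsWithin_le_nhds,
      Filter.Eventually.filter_mono nhdsWithin_le_nhds hmax] with x hx hxx hux hvx hmx
    refine ⟨hux, hvx, hmx, hg.reflect_lt ?_⟩
    simp only [slope_def_field, Pi.sub_apply, hderiv, sub_self, sub_zero] at hx
    exact sub_pos.1 ((div_pos_iff_of_pos_right (sub_pos.2 hxx)).1 hx)
  obtain ⟨b, hb, hsub⟩ := mem_nhdsGT_iff_exists_Ioc_subset.1 hev
  have hmono : StrictMonoOn (fun x => u x - v x) (Set.Icc x₀ b) := by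
    refine strictMonoOn_of_deriv_pos (convex_Icc x₀ b) ?_ ?_
    · intro x hx
      rcases hx.1.eq_or_lt with rfl | hlt'
      · exact (hu.self_of_nhds.sub hv.self_of_nhds).continuousAt.continuousWithinAt
      · have h := hsub ⟨hlt', hx.2⟩
        exact (h.1.sub h.2.1).continuousAt.continuousWithinAt
    · intro x hx
      rw [interior_Icc] at hx
      have h := hsub ⟨hx.1, hx.2.le⟩
      rw [deriv_fun_sub h.1 h.2.1]
      exact sub_pos.2 h.2.2.2
  have hb' : x₀ < b := hb
  exact (hmono (Set.left_mem_Icc.2 hb'.le) (Set.right_mem_Icc.2 hb'.le) hb').not_ge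
    (hsub ⟨hb', le_rfl⟩).2.2.1

/-- **Weak solutions are viscosity solutions** (Section 5). A weak solution of
`-|u'|^α u'' = f_{a,A}(u)` on an open interval `I` is a viscosity solution of
`|u'|^α u'' + f_{a,A}(u) = 0` on `I`: (i) on any nonempty open subinterval where
`u` is constant equal to `c`, `f_{a,A}(c) = 0`; (ii) at a local max of `u - φ`
with `φ'(x₀) ≠ 0`, `|φ'(x₀)|^α φ''(x₀) + f_{a,A}(u(x₀)) ≥ 0`; (iii) at a local min
with `φ'(x₀) ≠ 0`, `|φ'(x₀)|^α φ''(x₀) + f_{a,A}(u(x₀)) ≤ 0`. -/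
theorem weak_implies_viscosity
    (α a A : ℝ) (hα : -1 < α) (ha : 0 < a) (haA : a ≤ A)
    (f : ℝ → ℝ) (hf : ContDiff ℝ 1 f)
    (hfm1 : f (-1) = 0) (hf0 : f 0 = 0) (hf1 : f 1 = 0)
    (hfpos : ∀ t ∈ Set.Ioo (0:ℝ) 1, 0 < f t)
    (hfneg : ∀ t ∈ Set.Ioo (-1:ℝ) 0, f t < 0)
    (hfge : ∀ t : ℝ, t ≤ -1 → 0 ≤ f t)
    (hfle : ∀ t : ℝ, 1 ≤ t → f t ≤ 0)
    (I : Set ℝ) (hIopen : IsOpen I) (hIconn : I.OrdConnected)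
    (u : ℝ → ℝ)
    (hdiff : ∀ x ∈ I, DifferentiableAt ℝ u x)
    (hcont : ContinuousOn (deriv u) I)
    (hweak : ∀ x ∈ I, HasDerivAt (fun y => |deriv u y| ^ α * deriv u y)
      (-(1 + α) * faA a A f (u x)) x) :
    (∀ c : ℝ, ∀ J : Set ℝ, IsOpen J → J.OrdConnected → J.Nonempty → J ⊆ I →
      (∀ x ∈ J, u x = c) → faA a A f c = 0) ∧
    (∀ x₀ ∈ I, ∀ φ : ℝ → ℝ, ContDiff ℝ 2 φ →
      IsLocalMax (fun x => u x - φ x) x₀ → deriv φ x₀ ≠ 0 →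
      0 ≤ |deriv φ x₀| ^ α * deriv (deriv φ) x₀ + faA a A f (u x₀)) ∧
    (∀ x₀ ∈ I, ∀ φ : ℝ → ℝ, ContDiff ℝ 2 φ →
      IsLocalMin (fun x => u x - φ x) x₀ → deriv φ x₀ ≠ 0 →
      |deriv φ x₀| ^ α * deriv (deriv φ) x₀ + faA a A f (u x₀) ≤ 0) := by
  have h1 : 0 < 1 + α := by linarith
  have hu : ∀ x ∈ I, ∀ᶠ y in 𝓝 x, DifferentiableAt ℝ u y := fun x hx =>
    Filter.mem_of_superset (hIopen.mem_nhds hx) hdiff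
  have hφdiff : ∀ φ : ℝ → ℝ, ContDiff ℝ 2 φ → Differentiable ℝ φ := fun φ hφ =>
    hφ.differentiable (by norm_num)
  have hφderiv : ∀ φ : ℝ → ℝ, ContDiff ℝ 2 φ → ∀ x, deriv φ x ≠ 0 →
      HasDerivAt (fun y => |deriv φ y| ^ α * deriv φ y)
        ((1 + α) * |deriv φ x| ^ α * deriv (deriv φ) x) x := by
    intro φ hφ x hx
    have hφ' : ContDiff ℝ (1 + 1) φ := by simpa [one_add_one_eq_two] using hφ
    have hd : Differentiable ℝ (deriv φ) :=
      (contDiff_succ_iff_deriv.1 hφ').2.2.differentiable (by norm_num)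
    exact (hasDerivAt_abs_rpow_mul_self hα hx).comp x (hd x).hasDerivAt
  refine ⟨?_, ?_, ?_⟩
  · rintro c J hJ - ⟨x, hx⟩ hJI hc
    have hzero : (fun y => |deriv u y| ^ α * deriv u y) =ᶠ[𝓝 x] fun _ => 0 := by
      filter_upwards [hJ.mem_nhds hx] with y hy
      have hconst : u =ᶠ[𝓝 y] fun _ => c := Filter.mem_of_superset (hJ.mem_nhds hy) hc
      rw [hconst.deriv_eq, deriv_const, mul_zero]
    have h := (hweak x (hJI hx)).unique ((hasDerivAt_const x (0 : ℝ)).congr_of_eventuallyEq hzero)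
    rw [hc x hx] at h
    exact (mul_eq_zero.1 h).resolve_left (neg_ne_zero.2 h1.ne')
  · intro x hx φ hφ hmax hne
    have h := hmax.hasDerivAt_comp_deriv_le (monotone_abs_rpow_mul_self hα) (hu x hx)
      (.of_forall (hφdiff φ hφ)) (hweak x hx) (hφderiv φ hφ x hne)
    refine nonneg_of_mul_nonneg_right (a := 1 + α) ?_ h1
    linarith
  · intro x hx φ hφ hmin hne
    have hmax : IsLocalMax (fun y => φ y - u y) x := by
      simpa only [neg_sub] using hmin.neg
    have h := hmax.hasDerivAt_comp_deriv_le (monotone_abs_rpow_mul_self hα)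
      (.of_forall (hφdiff φ hφ)) (hu x hx) (hφderiv φ hφ x hne) (hweak x hx)
    refine nonpos_of_mul_nonpos_right (a := 1 + α) ?_ h1
    linarith
end
end

section
/- If δ > δ₁, then u_δ′(x) ≥ (δ^{2+α} − δ₁^{2+α})^{1/(2+α)} > 0 for every x ∈ ℝ. Consequently u_δ is increasing on ℝ, u_δ(x) ≥ C·x for all x ≥ 0 and u_δ(x) ≤ C·x for all x ≤ 0 with C = (δ^{2+α} − δ₁^{2+α})^{1/(2+α)}, and lim_{x→+∞} u_δ(x) = +∞, lim_{x→−∞} u_δ(x) = −∞. -/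
noncomputable section

open Real Filter Topology intervalIntegral

lemma faA_eq_max_div_add_min_div (a A : ℝ) (f : ℝ → ℝ) (t : ℝ) :
    faA a A f t = max (f t) 0 / a + min (f t) 0 / A := by
  unfold faA
  split_ifs with h h'
  · simp [max_eq_left h.le, min_eq_right h.le]
  · simp [max_eq_right h'.le, min_eq_left h'.le]
  · simp [le_antisymm (not_lt.1 h) (not_lt.1 h')]

lemma continuous_faA (a A : ℝ) {f : ℝ → ℝ} (hf : Continuous f) : Continuous (faA a A f) := by
  rw [funext (faA_eq_max_div_add_min_div a A f)]
  fun_prop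

lemma abs_abs_rpow_mul_self_rpow {α : ℝ} (hα : -1 < α) (d r : ℝ) (hr : r ≠ 0) :
    |(|d| ^ α * d)| ^ r = |d| ^ ((1 + α) * r) := by
  rcases eq_or_ne d 0 with rfl | hd
  · simp [Real.zero_rpow hr, Real.zero_rpow (mul_ne_zero (by linarith : 1 + α ≠ 0) hr)]
  · have hd' : 0 < |d| := abs_pos.2 hd
    rw [abs_mul, abs_of_nonneg (Real.rpow_nonneg hd'.le _), Real.rpow_mul hd'.le, add_comm,
      Real.rpow_add hd', Real.rpow_one]

lemma abs_flux_rpow_mul_flux {α : ℝ} (hα : -1 < α) (d : ℝ) :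
    |(|d| ^ α * d)| ^ ((2 + α) / (1 + α) - 2) * (|d| ^ α * d) = d := by
  rcases eq_or_ne d 0 with rfl | hd
  · simp
  · have hd' : 0 < |d| := abs_pos.2 hd
    have h1 : 1 + α ≠ 0 := by linarith
    rw [abs_mul, abs_of_nonneg (Real.rpow_nonneg hd'.le _)]
    have h2 : |d| ^ α * |d| = |d| ^ (1 + α) := by
      rw [add_comm, Real.rpow_add hd', Real.rpow_one]
    rw [h2, ← Real.rpow_mul hd'.le, ← mul_assoc, ← Real.rpow_add hd']
    have h3 : (1 + α) * ((2 + α) / (1 + α) - 2) + α = 0 := by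
      field_simp
      ring
    rw [h3, Real.rpow_zero, one_mul]

/-- Conservation of the energy `|u'|^(2+α) + (2+α) ∫₀ᵘ f_{a,A}` along a weak solution. -/
lemma IsWeakSolR.energy_eq {α a A : ℝ} {f u : ℝ → ℝ} (hα : -1 < α) (hf : Continuous f)
    (hu : IsWeakSolR α a A f u) (x y : ℝ) :
    |deriv u x| ^ (2 + α) + (2 + α) * ∫ s in (0:ℝ)..u x, faA a A f s =
      |deriv u y| ^ (2 + α) + (2 + α) * ∫ s in (0:ℝ)..u y, faA a A f s := by
  obtain ⟨hdiff, -, hflux⟩ := hu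
  have h1 : 0 < 1 + α := by linarith
  have hp : 1 < (2 + α) / (1 + α) := by
    rw [lt_div_iff₀ h1]
    linarith
  have hg := continuous_faA a A hf
  have key : ∀ z, HasDerivAt
      (fun z => |deriv u z| ^ (2 + α) + (2 + α) * ∫ s in (0:ℝ)..u z, faA a A f s) 0 z := by
    intro z
    have hkin := (hasDerivAt_abs_rpow (|deriv u z| ^ α * deriv u z) hp).comp z (hflux z)
    have hpot := ((hg.integral_hasStrictDerivAt 0 (u z)).hasDerivAt.comp z
      (hdiff z).hasDerivAt).const_mul (2 + α)
    have hsum := hkin.add hpot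
    rw [mul_assoc (_ / _), abs_flux_rpow_mul_flux hα] at hsum
    have h0 : (2 + α) / (1 + α) * deriv u z * (-(1 + α) * faA a A f (u z)) +
        (2 + α) * (faA a A f (u z) * deriv u z) = 0 := by
      field_simp
      ring
    rw [h0] at hsum
    refine hsum.congr_of_eventuallyEq (Eventually.of_forall fun w => ?_)
    have := abs_abs_rpow_mul_self_rpow hα (deriv u w) _ (zero_lt_one.trans hp).ne'
    rw [mul_div_cancel₀ _ h1.ne'] at this
    simp only [Pi.add_apply, Function.comp_apply, this]
  exact is_const_of_deriv_eq_zero (fun z => (key z).differentiableAt) (fun z => (key z).deriv) x y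

lemma mul_le_of_le_deriv {u : ℝ → ℝ} {C : ℝ} (hu : Differentiable ℝ u) (hu0 : u 0 = 0)
    (hC : ∀ x, C ≤ deriv u x) :
    (∀ x, 0 ≤ x → C * x ≤ u x) ∧ ∀ x, x ≤ 0 → u x ≤ C * x := by
  have hmul := mul_sub_le_image_sub_of_le_deriv hu hC
  constructor
  · intro x hx
    simpa [hu0] using hmul hx
  · intro x hx
    have := hmul hx
    rw [hu0] at this
    linarith

/-- A continuous function with no zeros that is positive at one point is positive everywhere. -/
lemma pos_of_continuous_of_ne_zero {g : ℝ → ℝ} (hg : Continuous g) (h0 : ∀ x, g x ≠ 0)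
    {y : ℝ} (hy : 0 < g y) (x : ℝ) : 0 < g x := by
  by_contra! hx
  obtain ⟨z, hz⟩ := mem_range_of_exists_le_of_exists_ge hg ⟨x, hx⟩ ⟨y, hy.le⟩
  exact h0 z hz

/-- **Proposition 5.2, case 1.** If `δ > δ₁`, then
`u_δ' ≥ (δ^{2+α} - δ₁^{2+α})^{1/(2+α)} > 0` everywhere; hence `u_δ` is
increasing, `u_δ(x) ≥ Cx` for `x ≥ 0`, `u_δ(x) ≤ Cx` for `x ≤ 0`, and
`u_δ → ±∞` as `x → ±∞`. -/
theorem cauchy_case_supercritical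
    (α a A : ℝ) (hα : -1 < α) (hα0 : α ≤ 0) (ha : 0 < a) (haA : a ≤ A)
    (f : ℝ → ℝ) (hf : ContDiff ℝ 1 f)
    (hfm1 : f (-1) = 0) (hf0 : f 0 = 0) (hf1 : f 1 = 0)
    (hfpos : ∀ t ∈ Set.Ioo (0:ℝ) 1, 0 < f t)
    (hfneg : ∀ t ∈ Set.Ioo (-1:ℝ) 0, f t < 0)
    (hfge : ∀ t : ℝ, t ≤ -1 → 0 ≤ f t)
    (hfle : ∀ t : ℝ, 1 ≤ t → f t ≤ 0)
    (hfbd : ∃ K : ℝ, ∀ t, |f t| ≤ K)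
    (hfLip : ∃ K : NNReal, LipschitzWith K f)
    (hfd1 : deriv f 1 < 0) (hfdm1 : deriv f (-1) < 0)
    (hbal : (∫ s in (-1:ℝ)..1, faA a A f s) = 0)
    (hint : ∀ t : ℝ, t ≠ -1 → t ≠ 1 → 0 < ∫ s in t..1, faA a A f s)
    (δ δ₁ : ℝ)
    (hδ₁ : δ₁ = ((2 + α) * ∫ s in (0:ℝ)..1, f s / a) ^ ((1:ℝ) / (2 + α)))
    (u : ℝ → ℝ) (hu : IsWeakSolR α a A f u)
    (hu0 : u 0 = 0) (hud0 : deriv u 0 = δ)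
    (hδ : δ₁ < δ) :
    0 < (δ ^ (2 + α) - δ₁ ^ (2 + α)) ^ ((1:ℝ) / (2 + α)) ∧
    (∀ x : ℝ, (δ ^ (2 + α) - δ₁ ^ (2 + α)) ^ ((1:ℝ) / (2 + α)) ≤ deriv u x) ∧
    StrictMono u ∧
    (∀ x : ℝ, 0 ≤ x → (δ ^ (2 + α) - δ₁ ^ (2 + α)) ^ ((1:ℝ) / (2 + α)) * x ≤ u x) ∧
    (∀ x : ℝ, x ≤ 0 → u x ≤ (δ ^ (2 + α) - δ₁ ^ (2 + α)) ^ ((1:ℝ) / (2 + α)) * x) ∧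
    Tendsto u atTop atTop ∧ Tendsto u atBot atBot := by
  have hg := continuous_faA a A hf.continuous
  have hα2 : 0 < 2 + α := by linarith
  have hF1 : ∫ s in (0:ℝ)..1, f s / a = ∫ s in (0:ℝ)..1, faA a A f s := by
    refine intervalIntegral.integral_congr fun s hs => ?_
    rw [Set.uIcc_of_le zero_le_one] at hs
    rcases hs.1.eq_or_lt with rfl | h0
    · simp [faA, hf0]
    rcases hs.2.eq_or_lt with rfl | h1
    · simp [faA, hf1]
    · simp [faA, hfpos s ⟨h0, h1⟩]
  have hF1pos : 0 < ∫ s in (0:ℝ)..1, faA a A f s := hint 0 (by norm_num) (by norm_num)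
  have hFle : ∀ t, ∫ s in (0:ℝ)..t, faA a A f s ≤ ∫ s in (0:ℝ)..1, faA a A f s := by
    intro t
    have htail : 0 ≤ ∫ s in t..1, faA a A f s := by
      by_cases ht : t = -1
      · rw [ht, hbal]
      by_cases ht' : t = 1
      · simp [ht']
      · exact (hint t ht ht').le
    have := intervalIntegral.integral_add_adjacent_intervals
      (hg.intervalIntegrable 0 t) (hg.intervalIntegrable (μ := MeasureTheory.volume) t 1)
    linarith
  rw [hF1] at hδ₁
  have hδ₁nonneg : 0 ≤ δ₁ := hδ₁ ▸ Real.rpow_nonneg (by positivity) _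
  have hδpos : 0 < δ := hδ₁nonneg.trans_lt hδ
  have hδ₁pow : δ₁ ^ (2 + α) = (2 + α) * ∫ s in (0:ℝ)..1, faA a A f s := by
    rw [hδ₁, one_div, Real.rpow_inv_rpow (by positivity) hα2.ne']
  have hgap : 0 < δ ^ (2 + α) - δ₁ ^ (2 + α) :=
    sub_pos.2 (Real.rpow_lt_rpow hδ₁nonneg hδ hα2)
  have hC : 0 < (δ ^ (2 + α) - δ₁ ^ (2 + α)) ^ ((1:ℝ) / (2 + α)) := Real.rpow_pos_of_pos hgap _
  have habs : ∀ x, (δ ^ (2 + α) - δ₁ ^ (2 + α)) ^ ((1:ℝ) / (2 + α)) ≤ |deriv u x| := by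
    intro x
    have henergy := hu.energy_eq hα hf.continuous x 0
    rw [hu0, hud0, intervalIntegral.integral_same, abs_of_pos hδpos] at henergy
    rw [one_div, Real.rpow_inv_le_iff_of_pos hgap.le (abs_nonneg _) hα2]
    have := mul_le_mul_of_nonneg_left (hFle (u x)) hα2.le
    linarith
  have hpos := pos_of_continuous_of_ne_zero hu.2.1
    (fun x => abs_pos.1 (hC.trans_le (habs x))) (hud0 ▸ hδpos)
  have hderiv : ∀ x, (δ ^ (2 + α) - δ₁ ^ (2 + α)) ^ ((1:ℝ) / (2 + α)) ≤ deriv u x :=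
    fun x => abs_of_pos (hpos x) ▸ habs x
  obtain ⟨hright, hleft⟩ := mul_le_of_le_deriv hu.1 hu0 hderiv
  refine ⟨hC, hderiv, strictMono_of_deriv_pos hpos, hright, hleft, ?_, ?_⟩
  · exact tendsto_atTop_mono' _ ((eventually_ge_atTop 0).mono hright)
      (tendsto_id.const_mul_atTop hC)
  · exact tendsto_atBot_mono' _ ((eventually_le_atBot 0).mono hleft)
      (tendsto_id.const_mul_atBot hC)
end
end

section
/- The function u(x) = sin x satisfies: x ↦ |u′(x)|² u′(x) = cos³ x is C¹ on ℝ with derivative equal to −3·(u(x) − u(x)³), so that u is a weak solution on ℝ of |u′|² u″ + u − u³ = 0 (the case α = 2, a = A = 1, f(t) = t − t³); moreover u(0) = 0 and u′(0) = 1 = (4 ∫₀¹ (s − s³) ds)^{1/4} = δ₁, yet u is 2π-periodic, takes both signs infinitely often, and does not converge to ±1 as x → ±∞. Hence for α = 2 the initial slope δ = δ₁ does not force the solution to be the increasing heteroclinic connection, i.e. assertion 2) of the Proposition on the Cauchy problem fails when α > 0. -/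
noncomputable section

open Real Filter Topology intervalIntegral

/-- Every value of the sine is attained arbitrarily far to the right and to the left. -/
theorem exists_gt_and_exists_lt_sin_eq (a R : ℝ) :
    (∃ x : ℝ, R < x ∧ Real.sin x = Real.sin a) ∧
      (∃ x : ℝ, x < R ∧ Real.sin x = Real.sin a) := by
  constructor
  · obtain ⟨n, hn⟩ := exists_nat_gt ((R - a) / (2 * π))
    rw [div_lt_iff₀ Real.two_pi_pos] at hn
    exact ⟨a + n * (2 * π), by linarith, Real.sin_add_nat_mul_two_pi a n⟩
  · obtain ⟨n, hn⟩ := exists_nat_gt ((a - R) / (2 * π))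
    rw [div_lt_iff₀ Real.two_pi_pos] at hn
    exact ⟨a - n * (2 * π), by linarith, Real.sin_sub_nat_mul_two_pi a n⟩

/-- **The sine counterexample for `α > 0`** (Remark 5.2). For `α = 2` and
`h(t) = t - t³`, `u = sin` satisfies `|u'|² u' = cos³`, which is C¹ with derivative
`-3(u - u³)`, so `u` is a weak solution of `|u'|² u'' + u - u³ = 0` on `ℝ`;
moreover `u(0) = 0` and `u'(0) = 1 = δ₁ = (4∫₀¹(s - s³)ds)^{1/4}`, yet `sin` is
`2π`-periodic, takes both signs arbitrarily far out, and converges to neither `1`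
at `+∞` nor `-1` at `-∞`. Hence case 2) of Proposition 5.2 fails for `α > 0`. -/
theorem sine_counterexample_alpha_pos :
    (∀ x : ℝ, |deriv Real.sin x| ^ 2 * deriv Real.sin x = Real.cos x ^ 3) ∧
    (∀ x : ℝ, HasDerivAt (fun y : ℝ => Real.cos y ^ 3)
      (-3 * (Real.sin x - Real.sin x ^ 3)) x) ∧
    Continuous (fun x : ℝ => -3 * (Real.sin x - Real.sin x ^ 3)) ∧
    Real.sin 0 = 0 ∧ deriv Real.sin 0 = 1 ∧
    (((2 + 2 : ℝ) * ∫ s in (0:ℝ)..1, (s - s ^ 3)) ^ ((1:ℝ) / (2 + 2)) : ℝ) = 1 ∧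
    (∀ x : ℝ, Real.sin (x + 2 * π) = Real.sin x) ∧
    (∀ R : ℝ, ∃ x : ℝ, R < x ∧ 0 < Real.sin x) ∧
    (∀ R : ℝ, ∃ x : ℝ, R < x ∧ Real.sin x < 0) ∧
    ¬ Tendsto Real.sin atTop (𝓝 1) ∧
    ¬ Tendsto Real.sin atBot (𝓝 (-1)) := by
  refine ⟨fun x => ?_, fun x => ?_, by fun_prop, Real.sin_zero, by simp, ?_,
    Real.sin_add_two_pi, fun R => ?_, fun R => ?_, fun h => ?_, fun h => ?_⟩
  · rw [Real.deriv_sin, sq_abs]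
    ring
  · refine ((Real.hasDerivAt_cos x).pow 3).congr_deriv ?_
    push_cast
    linear_combination (-3 * Real.sin x) * Real.sin_sq_add_cos_sq x
  · have hI : ∫ s in (0:ℝ)..1, (s - s ^ 3) = 1 / 4 := by
      rw [intervalIntegral.integral_sub (by simp) (by simp), integral_id, integral_pow]
      norm_num
    rw [hI]
    norm_num
  · obtain ⟨x, hx, hsin⟩ := (exists_gt_and_exists_lt_sin_eq (π / 2) R).1
    exact ⟨x, hx, by rw [hsin, Real.sin_pi_div_two]; norm_num⟩
  · obtain ⟨x, hx, hsin⟩ := (exists_gt_and_exists_lt_sin_eq (-(π / 2)) R).1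
    exact ⟨x, hx, by rw [hsin, Real.sin_neg, Real.sin_pi_div_two]; norm_num⟩
  · obtain ⟨R, hR⟩ := eventually_atTop.1 (h.eventually_ne one_ne_zero)
    obtain ⟨x, hx, hsin⟩ := (exists_gt_and_exists_lt_sin_eq 0 R).1
    exact hR x hx.le (hsin.trans Real.sin_zero)
  · obtain ⟨R, hR⟩ := eventually_atBot.1 (h.eventually_ne (neg_ne_zero.2 one_ne_zero))
    obtain ⟨x, hx, hsin⟩ := (exists_gt_and_exists_lt_sin_eq 0 R).2
    exact hR x hx.le (hsin.trans Real.sin_zero)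
end
end
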